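/- Let n ≥ 3, ζ ∈ ℝ^{n−1} and z ∈ ℂ with z ≠ 0 and Re z + |ζ|² > 0, and let τ₀ = i√(z + |ζ|²) be the root with positive imaginary part of τ² + |ζ|² + z = 0. Suppose v = (v_{ij}) is a symmetric n×n complex matrix (indices α,β,γ,ε ranging over 1,…,n−1) satisfying, with φ := (n−1)^{−1} Σ_γ v_{γγ}: (i) Σ_γ ζ_γ v_{γα} + τ₀ v_{nα} − (1/2) ζ_α (Σ_γ v_{γγ} + v_{nn}) = 0 for all α; (ii) Σ_γ ζ_γ v_{γn} + (1/2) τ₀ v_{nn} − (1/2) τ₀ Σ_γ v_{γγ} = 0; (iii) v_{αβ} − φ δ_{αβ} = 0 for all α,β; (iv) Σ_α ζ_α v_{αn} − (1/2) τ₀ Σ_γ v_{γγ} = 0. Then v = 0. -/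

import Mathlib

/-- **The algebraic complementarity (Lopatinskii–Shapiro) condition for the linearized
Ricci–deTurck boundary value problem** (from the proof of Proposition 5.1).
Let `n ≥ 3`, `ζ ∈ ℝ^{n−1}`, `z ∈ ℂ` with `z ≠ 0` and `Re z + |ζ|² > 0`, and let `τ₀`
be the root with positive imaginary part of `τ² + |ζ|² + z = 0` (i.e.
`τ₀ = i√(z + |ζ|²)`).  If `v = (v_{ij})` is a symmetric `n×n` complex matrix whose
entries satisfy the principal boundary symbol equations (i)–(iv) below, with
`φ = (n−1)^{−1} Σ_γ v_{γγ}`, then `v = 0`.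

Here boundary indices `α, β, γ` range over `Fin (n−1)`, embedded into `Fin n` by
`e = Fin.castLE`, and `N ∈ Fin n` is the last index (`N = n − 1`). -/
theorem complementarity_condition_linearized_RdT
    (n : ℕ) (hn : 3 ≤ n)
    (ζ : Fin (n - 1) → ℝ) (z : ℂ) (hz : z ≠ 0)
    (hRe : 0 < z.re + ∑ γ, ζ γ ^ 2)
    (τ₀ : ℂ)
    (hτroot : τ₀ ^ 2 + ((∑ γ, ζ γ ^ 2 : ℝ) : ℂ) + z = 0)
    (hτim : 0 < τ₀.im)
    (v : Fin n → Fin n → ℂ) (hsymm : ∀ i j, v i j = v j i)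
    (e : Fin (n - 1) → Fin n) (he : ∀ α, e α = Fin.castLE (Nat.sub_le n 1) α)
    (N : Fin n) (hN : (N : ℕ) = n - 1)
    (φ : ℂ) (hφ : φ = ((n : ℂ) - 1)⁻¹ * ∑ γ, v (e γ) (e γ))
    -- (i): principal symbol of the Bianchi-gauge boundary operator, tangential part
    (h1 : ∀ α, (∑ γ, (ζ γ : ℂ) * v (e γ) (e α)) + τ₀ * v N (e α)
        - (1/2 : ℂ) * (ζ α : ℂ) * ((∑ γ, v (e γ) (e γ)) + v N N) = 0)
    -- (ii): principal symbol of the Bianchi-gauge boundary operator, normal part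
    (h2 : (∑ γ, (ζ γ : ℂ) * v (e γ) N)
        + (1/2 : ℂ) * τ₀ * v N N - (1/2 : ℂ) * τ₀ * (∑ γ, v (e γ) (e γ)) = 0)
    -- (iii): symbol of the trace-free conformal boundary operator (divided by z)
    (h3 : ∀ α β, v (e α) (e β) - φ * (if α = β then 1 else 0) = 0)
    -- (iv): symbol of the mean-curvature-evolution operator (divided by iz)
    (h4 : (∑ α, (ζ α : ℂ) * v (e α) N) - (1/2 : ℂ) * τ₀ * (∑ γ, v (e γ) (e γ)) = 0) :
    v = 0 := by
  have hτ : τ₀ ≠ 0 := by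
    rintro rfl
    simp at hτim
  have hvNN : v N N = 0 := by
    have : τ₀ * v N N = 0 := by linear_combination 2 * h2 - 2 * h4
    exact (mul_eq_zero.mp this).resolve_left hτ
  have h3' : ∀ α β, v (e α) (e β) = φ * (if α = β then 1 else 0) :=
    fun α β => sub_eq_zero.mp (h3 α β)
  have hT : (∑ γ, v (e γ) (e γ)) = ((n : ℂ) - 1) * φ := by
    simp only [h3', if_true, mul_one, Finset.sum_const, Finset.card_univ, Fintype.card_fin,
      nsmul_eq_mul]
    rw [Nat.cast_sub (by omega)]
    simp
  rw [hT] at h2 h4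
  have h1' : ∀ α, (ζ α : ℂ) * φ + τ₀ * v (e α) N
      - (1/2 : ℂ) * (ζ α : ℂ) * (((n : ℂ) - 1) * φ) = 0 := by
    intro α
    have h := h1 α
    rw [hT, hvNN, hsymm N (e α)] at h
    have hs : (∑ γ, (ζ γ : ℂ) * v (e γ) (e α)) = (ζ α : ℂ) * φ := by
      simp [h3']
    rw [hs] at h
    linear_combination h
  have hsum : (∑ α, (ζ α : ℂ) * ((ζ α : ℂ) * φ + τ₀ * v (e α) N
      - (1/2 : ℂ) * (ζ α : ℂ) * (((n : ℂ) - 1) * φ))) = 0 :=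
    Finset.sum_eq_zero fun α _ => by rw [h1' α, mul_zero]
  have hsum2 : (∑ α, (ζ α : ℂ) * ((ζ α : ℂ) * φ + τ₀ * v (e α) N
      - (1/2 : ℂ) * (ζ α : ℂ) * (((n : ℂ) - 1) * φ)))
      = ((∑ γ, ζ γ ^ 2 : ℝ) : ℂ) * (φ - (1/2 : ℂ) * (((n : ℂ) - 1) * φ))
        + τ₀ * ∑ α, (ζ α : ℂ) * v (e α) N := by
    push_cast
    rw [Finset.sum_mul, Finset.mul_sum, ← Finset.sum_add_distrib]
    exact Finset.sum_congr rfl fun α _ => by ring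
  rw [hsum2] at hsum
  have hs0 : 0 ≤ ∑ γ, ζ γ ^ 2 := Finset.sum_nonneg fun γ _ => sq_nonneg _
  generalize (∑ γ, ζ γ ^ 2) = s at *
  have hφ0 : φ = 0 := by
    have hp : φ * ((2 * (n : ℂ) - 4) * (s : ℂ) + ((n : ℂ) - 1) * z) = 0 := by
      linear_combination (-2) * hsum + 2 * τ₀ * h4 + ((n : ℂ) - 1) * φ * hτroot
    refine (mul_eq_zero.mp hp).resolve_right fun h => ?_
    have hr := congrArg Complex.re h
    have hc : (2 * (n : ℂ) - 4) * (s : ℂ) + ((n : ℂ) - 1) * z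
        = (((2 * (n : ℝ) - 4) * s : ℝ) : ℂ) + (((n : ℝ) - 1 : ℝ) : ℂ) * z := by
      push_cast; ring
    rw [hc, Complex.add_re, Complex.re_ofReal_mul, Complex.ofReal_re, Complex.zero_re] at hr
    have hn' : (3 : ℝ) ≤ n := by exact_mod_cast hn
    have a : 0 < ((n : ℝ) - 1) * (z.re + s) := mul_pos (by linarith) hRe
    have b : 0 ≤ ((n : ℝ) - 3) * s := mul_nonneg (by linarith) hs0
    nlinarith
  have hαN : ∀ α, v (e α) N = 0 := by
    intro α
    have h := h1' α
    rw [hφ0] at h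
    have : τ₀ * v (e α) N = 0 := by linear_combination h
    exact (mul_eq_zero.mp this).resolve_left hτ
  have hcase : ∀ i : Fin n, i = N ∨ ∃ α, i = e α := by
    intro i
    by_cases hi : (i : ℕ) = n - 1
    · exact Or.inl (Fin.ext (hi.trans hN.symm))
    · refine Or.inr ⟨⟨i, by omega⟩, ?_⟩
      rw [he]
      rfl
  funext i j
  rcases hcase i with rfl | ⟨α, rfl⟩ <;> rcases hcase j with hj | ⟨β, rfl⟩
  · rw [hj, hvNN]; rfl
  · rw [hsymm, hαN]; rfl
  · rw [hj, hαN]; rfl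
  · rw [h3', hφ0, zero_mul]; rfl
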